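/- Let ℋ be the class of all 1-Lipschitz functions from ([0,1]^d, ‖·‖_∞) to [0,1] and let ℓ be the absolute loss ℓ(ŷ,y) = |ŷ − y|. Then there exist constants C, c > 0 (depending only on d) and a prediction rule Φ such that the hybrid minimax regret satisfies r̃_T(ℋ,Φ) ≤ C·(log T)^c·T^{max{1/2,(d−1)/d}} for all T ≥ 2. -/

import Mathlib

open MeasureTheory Real Set

noncomputable section

/-- The unit interval `[0,1]` as a type. -/
abbrev UI : Type := Set.Icc (0:ℝ) 1

/-- sign of a boolean coin flip -/
def sgn (b : Bool) : ℝ := if b then 1 else -1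

/-- A prediction rule: given the history `(x₁,y₁),…,(x_{t-1},y_{t-1})` and the current
feature `x_t`, it outputs a probability distribution over `[0,1]`. -/
abbrev PredRule (X : Type) [MeasurableSpace X] : Type :=
  List (X × ℝ) → X → ProbabilityMeasure UI

/-- cumulative loss of an expert `h` on a realized feature/label history -/
def histLoss {X : Type} (ℓ : ℝ → ℝ → ℝ) (h : X → ℝ) (hist : List (X × ℝ)) : ℝ :=
  (hist.map (fun p => ℓ (h p.1) p.2)).sum

/-- The value of the hybrid online learning game with `r` rounds remaining:
at each round, Nature samples `x ∼ μ`, adversarially picks `y ∈ [0,1]`,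
and the learner plays `yh ∼ Φ(hist, x)`, paying `ℓ(yh,y)`; at the end the cumulative
loss of the best expert in `H` is subtracted. -/
def gameVal {X : Type} [MeasurableSpace X] (H : Set (X → ℝ)) (ℓ : ℝ → ℝ → ℝ)
    (μ : Measure X) (Φ : PredRule X) : ℕ → List (X × ℝ) → ℝ
  | 0, hist => - ⨅ h : H, histLoss ℓ (h : X → ℝ) hist
  | (r+1), hist =>
      ∫ x, (⨆ y : UI,
        ((∫ yh, ℓ (yh : ℝ) (y : ℝ) ∂((Φ hist x).toMeasure)) +
          gameVal H ℓ μ Φ r (hist ++ [(x, (y : ℝ))]))) ∂μ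

/-- The hybrid minimax regret `r̃_T(H,Φ)`. -/
def hybridRegret {X : Type} [MeasurableSpace X] (H : Set (X → ℝ)) (ℓ : ℝ → ℝ → ℝ)
    (Φ : PredRule X) (T : ℕ) : ℝ :=
  ⨆ μ : ProbabilityMeasure X, gameVal H ℓ (μ : Measure X) Φ T []

/-- Rademacher complexity of a class at horizon `T`. -/
def rad {X : Type} (H : Set (X → ℝ)) (T : ℕ) : ℝ :=
  ⨆ x : Fin T → X,
    (∑ ε : Fin T → Bool, ⨆ h : H, ∑ t, sgn (ε t) * (h : X → ℝ) (x t)) / 2 ^ T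

/-- `ℓ` is convex in its first argument (on `[0,1]`). -/
def LossConvex (ℓ : ℝ → ℝ → ℝ) : Prop :=
  ∀ y ∈ Icc (0:ℝ) 1, ConvexOn ℝ (Icc (0:ℝ) 1) (fun z => ℓ z y)

/-- `ℓ` is `L`-Lipschitz in both arguments (on `[0,1]`). -/
def LossLip (ℓ : ℝ → ℝ → ℝ) (L : ℝ) : Prop :=
  (∀ y ∈ Icc (0:ℝ) 1, ∀ a ∈ Icc (0:ℝ) 1, ∀ b ∈ Icc (0:ℝ) 1, |ℓ a y - ℓ b y| ≤ L * |a - b|) ∧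
  (∀ z ∈ Icc (0:ℝ) 1, ∀ a ∈ Icc (0:ℝ) 1, ∀ b ∈ Icc (0:ℝ) 1, |ℓ z a - ℓ z b| ≤ L * |a - b|)

/-- `ℓ` is nonnegative. -/
def LossNonneg (ℓ : ℝ → ℝ → ℝ) : Prop := ∀ a b, 0 ≤ ℓ a b

/-- the unit cube `[0,1]^d` as a subtype of `Fin d → ℝ` (whose norm is the sup norm) -/
abbrev Cube (d : ℕ) : Type := ↥(Set.Icc (0 : Fin d → ℝ) 1)

/-- the class of all `1`-Lipschitz functions `([0,1]^d, ‖·‖_∞) → [0,1]` -/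
def lipClass (d : ℕ) : Set (Cube d → ℝ) :=
  {h | (∀ u, h u ∈ Icc (0:ℝ) 1) ∧
    ∀ u v : Cube d, |h u - h v| ≤ ‖(u : Fin d → ℝ) - (v : Fin d → ℝ)‖}

/-! ### The algorithm: a multi-scale family of projected gradient descents -/

/-- clipping to `[-R,R]` -/
def clipR (R a : ℝ) : ℝ := max (-R) (min R a)

/-- clipping to `[0,1]` -/
def clipU (a : ℝ) : ℝ := max 0 (min 1 a)

lemma clipU_mem (a : ℝ) : clipU a ∈ Icc (0:ℝ) 1 :=
  ⟨le_max_left _ _, max_le zero_le_one (min_le_left _ _)⟩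

lemma clipU_abs (a y : ℝ) (hy : y ∈ Icc (0:ℝ) 1) : |clipU a - y| ≤ |a - y| := by
  obtain ⟨h0, h1⟩ := hy
  unfold clipU
  rcases max_cases 0 (min 1 a) with h | h <;> rcases min_cases 1 a with h' | h' <;>
    rw [h.1] <;> (try rw [h'.1]) <;>
    rcases abs_cases (a - y) with h2 | h2 <;> rw [h2.1, abs_le] <;> constructor <;> linarith

lemma clipR_abs {R : ℝ} (hR : 0 ≤ R) (a : ℝ) : |clipR R a| ≤ R := by
  unfold clipR
  rw [abs_le]
  exact ⟨le_max_left _ _, max_le (by linarith) (min_le_left _ _)⟩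

lemma clipR_sq {R : ℝ} (a u : ℝ) (hu : |u| ≤ R) :
    (clipR R a - u) ^ 2 ≤ (a - u) ^ 2 := by
  rw [abs_le] at hu
  unfold clipR
  rcases max_cases (-R) (min R a) with h | h <;> rcases min_cases R a with h' | h' <;>
    rw [h.1] <;> (try rw [h'.1]) <;> nlinarith

/-- one-dimensional gradient of the absolute loss -/
def gradS (z y : ℝ) : ℝ := if y ≤ z then 1 else -1

lemma gradS_abs (z y : ℝ) : |gradS z y| ≤ 1 := by
  unfold gradS; split_ifs <;> simp

lemma gradS_sub (z y h : ℝ) : |z - y| - |h - y| ≤ gradS z y * (z - h) := by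
  unfold gradS
  split_ifs with hc
  · rw [abs_of_nonneg (by linarith)]
    have := le_abs_self (h - y)
    linarith
  · push Not at hc
    rw [abs_of_neg (by linarith)]
    have := neg_abs_le (h - y)
    linarith

/-- index of the dyadic cell of level `m` containing `x` -/
def key {d : ℕ} (m : ℕ) (x : Cube d) : Fin d → ℕ := fun i => ⌊(2:ℝ) ^ m * x.1 i⌋₊

/-- finite set of cells of level `m` -/
def cells (d m : ℕ) : Finset (Fin d → ℕ) :=
  Fintype.piFinset (fun _ => Finset.range (2 ^ m + 1))

lemma cube_nonneg {d : ℕ} (x : Cube d) (i : Fin d) : 0 ≤ x.1 i := x.2.1 i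
lemma cube_le_one {d : ℕ} (x : Cube d) (i : Fin d) : x.1 i ≤ 1 := x.2.2 i

lemma key_mem {d : ℕ} (m : ℕ) (x : Cube d) : key m x ∈ cells d m := by
  unfold cells key
  rw [Fintype.mem_piFinset]
  intro i
  rw [Finset.mem_range, Nat.lt_succ_iff]
  apply Nat.floor_le_of_le
  push_cast
  have := cube_le_one x i
  have h2 : (0:ℝ) < 2 ^ m := by positivity
  nlinarith

lemma cells_card (d m : ℕ) : (cells d m).card = (2 ^ m + 1) ^ d := by
  simp [cells, Fintype.card_piFinset]

lemma key_succ {d : ℕ} (m : ℕ) (x : Cube d) (i : Fin d) :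
    key (m + 1) x i / 2 = key m x i := by
  unfold key
  rw [← Nat.floor_div_natCast]
  congr 1
  push_cast
  ring

/-- corner of a cell -/
def corner {d : ℕ} (m : ℕ) (k : Fin d → ℕ) : Cube d :=
  ⟨fun i => min 1 ((k i : ℝ) / 2 ^ m), by
    constructor
    · intro i
      exact le_min zero_le_one (by positivity)
    · intro i
      exact min_le_left _ _⟩

/-- coefficient of the multi-scale decomposition of `h` -/
def coef {d : ℕ} (h : Cube d → ℝ) : ℕ → (Fin d → ℕ) → ℝ
  | 0, k => h (corner 0 k)
  | m + 1, k => h (corner (m + 1) k) - h (corner m (fun i => k i / 2))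

/-- radius of level `m` -/
def rad2 (m : ℕ) : ℝ := (1 / 2) ^ m

lemma rad2_pos (m : ℕ) : 0 < rad2 m := by unfold rad2; positivity

lemma coef_abs {d : ℕ} (h : Cube d → ℝ) (hh : h ∈ lipClass d) (m : ℕ) (k : Fin d → ℕ) :
    |coef h m k| ≤ rad2 m := by
  cases m with
  | zero =>
    have := hh.1 (corner 0 k)
    simp only [coef, rad2, pow_zero]
    rw [abs_of_nonneg this.1]
    exact this.2
  | succ m =>
    simp only [coef]
    refine (hh.2 _ _).trans ?_
    rw [pi_norm_le_iff_of_nonneg (rad2_pos _).le]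
    intro i
    simp only [corner, Pi.sub_apply, Real.norm_eq_abs, rad2]
    refine (abs_min_sub_min_le_max _ _ _ _).trans ?_
    rw [sub_self, abs_zero]
    apply max_le (by positivity)
    have e : (k i : ℝ) = 2 * ((k i / 2 : ℕ) : ℝ) + ((k i % 2 : ℕ) : ℝ) := by
      exact_mod_cast (Nat.div_add_mod (k i) 2).symm
    have e2 : ((k i % 2 : ℕ) : ℝ) ≤ 1 := by
      have : k i % 2 ≤ 1 := by omega
      exact_mod_cast this
    have e3 : (k i : ℝ) / 2 ^ (m + 1) - ((k i / 2 : ℕ) : ℝ) / 2 ^ m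
        = ((k i % 2 : ℕ) : ℝ) * (1 / 2) ^ (m + 1) := by
      rw [e, one_div, inv_pow]
      field_simp
      ring
    rw [e3, abs_of_nonneg (by positivity)]
    have : (0:ℝ) < (1 / 2) ^ (m + 1) := by positivity
    nlinarith

lemma coef_sum {d : ℕ} (h : Cube d → ℝ) (x : Cube d) (t : ℕ) :
    ∑ m ∈ Finset.range (t + 1), coef h m (key m x) = h (corner t (key t x)) := by
  induction t with
  | zero => simp [coef]
  | succ t ih =>
    rw [Finset.sum_range_succ, ih]
    simp only [coef, key_succ]
    ring_nf

lemma corner_dist {d : ℕ} (h : Cube d → ℝ) (hh : h ∈ lipClass d) (x : Cube d) (t : ℕ) :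
    |h (corner t (key t x)) - h x| ≤ (1 / 2) ^ t := by
  refine (hh.2 _ _).trans ?_
  rw [pi_norm_le_iff_of_nonneg (by positivity)]
  intro i
  have h0 := cube_nonneg x i
  have h1 := cube_le_one x i
  have hp : (0:ℝ) < 2 ^ t := by positivity
  have f1 : (⌊(2:ℝ) ^ t * x.1 i⌋₊ : ℝ) ≤ 2 ^ t * x.1 i := Nat.floor_le (by positivity)
  have f2 : (2:ℝ) ^ t * x.1 i < ⌊(2:ℝ) ^ t * x.1 i⌋₊ + 1 := Nat.lt_floor_add_one _
  simp only [corner, key, Pi.sub_apply, Real.norm_eq_abs]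
  have g1 : (⌊(2:ℝ) ^ t * x.1 i⌋₊ : ℝ) / 2 ^ t ≤ x.1 i := by
    rw [div_le_iff₀ hp]; linarith
  have g2 : x.1 i ≤ (⌊(2:ℝ) ^ t * x.1 i⌋₊ : ℝ) / 2 ^ t + (1 / 2) ^ t := by
    rw [one_div, inv_pow, ← one_div, ← add_div, le_div_iff₀ hp]; linarith
  rw [min_eq_right (g1.trans h1), abs_le]
  constructor <;> linarith [show (0:ℝ) < (1/2)^t by positivity]

/-- algorithm state: time, coefficients, cumulative loss -/
structure AState (d : ℕ) where
  t : ℕ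
  A : ℕ → (Fin d → ℕ) → ℝ
  L : ℝ

/-- unclipped prediction -/
def zpred {d : ℕ} (s : AState d) (x : Cube d) : ℝ :=
  ∑ m ∈ Finset.range (s.t + 1), s.A m (key m x)

/-- gradient fed to level `m` -/
def lgrad {d : ℕ} (s : AState d) (p : Cube d × ℝ) (m : ℕ) : ℝ :=
  if m < s.t + 1 then gradS (zpred s p.1) p.2 else 0

/-- square root of the number of cells -/
def sqD (d m : ℕ) : ℝ := √(((2:ℝ) ^ m + 1) ^ d)

lemma sqD_pos (d m : ℕ) : 0 < sqD d m := by unfold sqD; positivity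

lemma sqD_sq (d m : ℕ) : sqD d m ^ 2 = ((cells d m).card : ℝ) := by
  unfold sqD
  rw [Real.sq_sqrt (by positivity), cells_card]
  push_cast
  rfl

/-- one step -/
def astep {d : ℕ} (s : AState d) (p : Cube d × ℝ) : AState d where
  t := s.t + 1
  A := fun m => Function.update (s.A m) (key m p.1)
    (clipR (rad2 m) (s.A m (key m p.1) - rad2 m * sqD d m / √((s.t : ℝ) + 1) * lgrad s p m))
  L := s.L + |clipU (zpred s p.1) - p.2|

/-- state after a history -/
def astate {d : ℕ} (hist : List (Cube d × ℝ)) : AState d :=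
  hist.foldl astep ⟨0, fun _ _ => 0, 0⟩

lemma astate_append {d : ℕ} (hist : List (Cube d × ℝ)) (p : Cube d × ℝ) :
    astate (hist ++ [p]) = astep (astate hist) p := by
  simp [astate, List.foldl_append]

lemma astate_t {d : ℕ} (hist : List (Cube d × ℝ)) : (astate hist).t = hist.length := by
  induction hist using List.reverseRecOn with
  | nil => rfl
  | append_singleton l p ih => rw [astate_append]; simp [astep, ih]

lemma astate_A {d : ℕ} (hist : List (Cube d × ℝ)) (m : ℕ) (k : Fin d → ℕ) :
    |(astate hist).A m k| ≤ rad2 m := by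
  induction hist using List.reverseRecOn with
  | nil => simpa [astate] using (rad2_pos m).le
  | append_singleton l p ih =>
    rw [astate_append]
    simp only [astep]
    by_cases hk : k = key m p.1
    · subst hk
      rw [Function.update_self]
      exact clipR_abs (rad2_pos m).le _
    · rw [Function.update_of_ne hk]
      exact ih

lemma lgrad_abs {d : ℕ} (s : AState d) (p : Cube d × ℝ) (m : ℕ) : |lgrad s p m| ≤ 1 := by
  unfold lgrad
  split_ifs
  · exact gradS_abs _ _
  · simp

/-- one step of the gradient-descent potential argument (pure inequality) -/
lemma ogd_step (S R q a0 b0 a u g W W' n D : ℝ) (hR : 0 < R) (hq : 0 < q) (hD : D = q ^ 2)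
    (hn : 0 ≤ n)
    (hg : |g| ≤ 1) (hb : (b0 - u) ^ 2 ≤ (a - R * q / √(n + 1) * g - u) ^ 2)
    (haa : a = a0)
    (hW' : W' = W - (a0 - u) ^ 2 + (b0 - u) ^ 2) (hW : W ≤ D * (4 * R ^ 2))
    (hinv : S + √n / (2 * R * q) * W ≤ 3 * R * q * √n) :
    S + g * (a - u) + √(n + 1) / (2 * R * q) * W' ≤ 3 * R * q * √(n + 1) := by
  subst haa hD
  set s := √n with hs
  set r := √(n + 1) with hr
  have hr0 : 0 < r := Real.sqrt_pos.mpr (by linarith)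
  have hs0 : 0 ≤ s := Real.sqrt_nonneg _
  have hr2 : r ^ 2 = n + 1 := Real.sq_sqrt (by linarith)
  have hs2 : s ^ 2 = n := Real.sq_sqrt hn
  have hsr : s ≤ r := Real.sqrt_le_sqrt (by linarith)
  have hg2 : g ^ 2 ≤ 1 := by
    rw [← sq_abs]
    nlinarith [abs_nonneg g]
  have hk : r / (2 * R * q) * ((b0 - u) ^ 2 - (a - u) ^ 2) ≤ - g * (a - u) + R * q / (2 * r) := by
    have h1 : (b0 - u) ^ 2 - (a - u) ^ 2
        ≤ - 2 * (R * q / r) * g * (a - u) + (R * q / r) ^ 2 := by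
      have : (R * q / r) ^ 2 * g ^ 2 ≤ (R * q / r) ^ 2 * 1 :=
        mul_le_mul_of_nonneg_left hg2 (by positivity)
      nlinarith
    have h2 := mul_le_mul_of_nonneg_left h1 (show 0 ≤ r / (2 * R * q) by positivity)
    refine h2.trans (le_of_eq ?_)
    field_simp
  have h3 : (r - s) / (2 * R * q) * W ≤ (r - s) / (2 * R * q) * (q ^ 2 * (4 * R ^ 2)) :=
    mul_le_mul_of_nonneg_left hW (div_nonneg (by linarith) (by positivity))
  have h4 : (r - s) / (2 * R * q) * (q ^ 2 * (4 * R ^ 2)) = 2 * R * q * (r - s) := by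
    field_simp; ring
  have h5 : R * q / (2 * r) ≤ R * q * (r - s) := by
    rw [div_le_iff₀ (by positivity)]
    have : 1 ≤ (r - s) * (2 * r) := by nlinarith [sq_nonneg (r - s)]
    have hRq : 0 < R * q := by positivity
    nlinarith
  have h6 : r / (2 * R * q) * W' = s / (2 * R * q) * W + (r - s) / (2 * R * q) * W
      + r / (2 * R * q) * ((b0 - u) ^ 2 - (a - u) ^ 2) := by
    rw [hW']; field_simp; ring
  rw [h6]
  nlinarith

/-- the regret invariant -/
lemma regret_inv {d : ℕ} (N : ℕ) (h : Cube d → ℝ) (hh : h ∈ lipClass d)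
    (hist : List (Cube d × ℝ)) (hy : ∀ p ∈ hist, p.2 ∈ Icc (0:ℝ) 1) (hN : hist.length ≤ N) :
    ∃ Rg : ℕ → ℝ,
      (astate hist).L - histLoss (fun a b => |a - b|) h hist ≤
        ∑ m ∈ Finset.range N, Rg m + ∑ t ∈ Finset.range hist.length, (1 / 2 : ℝ) ^ t ∧
      ∀ m, Rg m ≤ 2 * rad2 m * hist.length ∧
        Rg m + √(hist.length : ℝ) / (2 * rad2 m * sqD d m) *
          ∑ k ∈ cells d m, ((astate hist).A m k - coef h m k) ^ 2
          ≤ 3 * rad2 m * sqD d m * √(hist.length : ℝ) := by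
  induction hist using List.reverseRecOn with
  | nil =>
    refine ⟨fun _ => 0, ?_, ?_⟩
    · simp [astate, histLoss]
    · intro m; simp
  | append_singleton l p ih =>
    obtain ⟨Rg, h1, h2⟩ := ih (fun q hq => hy q (by simp [hq])) (by simp at hN; omega)
    have hp : p.2 ∈ Icc (0:ℝ) 1 := hy p (by simp)
    set s := astate l with hs
    have hst : s.t = l.length := astate_t l
    have hlN : l.length + 1 ≤ N := by simpa using hN
    refine ⟨fun m => Rg m + lgrad s p m * (s.A m (key m p.1) - coef h m (key m p.1)), ?_, ?_⟩
    · rw [astate_append, List.length_append, List.length_singleton, Finset.sum_range_succ,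
        Finset.sum_add_distrib]
      have e1 : ∑ m ∈ Finset.range N, lgrad s p m * (s.A m (key m p.1) - coef h m (key m p.1))
          = gradS (zpred s p.1) p.2 * (zpred s p.1 - h (corner l.length (key l.length p.1))) := by
        rw [← coef_sum h p.1 l.length, zpred, hst, ← Finset.sum_sub_distrib, Finset.mul_sum]
        symm
        apply Finset.sum_subset_zero_on_sdiff
        · exact Finset.range_subset_range.mpr hlN
        · intro m hm
          have : ¬ m < s.t + 1 := by
            rw [hst]
            simpa using (Finset.mem_sdiff.mp hm).2
          simp only [lgrad, if_neg this, zero_mul]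
        · intro m hm
          have : m < l.length + 1 := Finset.mem_range.mp hm
          simp only [lgrad, zpred, hst, if_pos this]
      have e2 : histLoss (fun a b => |a - b|) h (l ++ [p])
          = histLoss (fun a b => |a - b|) h l + |h p.1 - p.2| := by
        simp [histLoss]
      rw [e1, e2]
      simp only [astep]
      have e3 := gradS_sub (zpred s p.1) p.2 (h (corner l.length (key l.length p.1)))
      have e4 := clipU_abs (zpred s p.1) p.2 hp
      have e5 := corner_dist h hh p.1 l.length
      have e6 : |h (corner l.length (key l.length p.1)) - p.2| ≤
          |h (corner l.length (key l.length p.1)) - h p.1| + |h p.1 - p.2| := abs_sub_le _ _ _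
      linarith
    · intro m
      obtain ⟨i1, i2⟩ := h2 m
      have hA := astate_A l m
      have hc := coef_abs h hh m
      have hg := lgrad_abs s p m
      have hR := rad2_pos m
      have hdiff : ∀ k, |s.A m k - coef h m k| ≤ 2 * rad2 m := fun k => by
        have := abs_sub (s.A m k) (coef h m k)
        have := hA k
        have := hc k
        linarith
      have hlen : ((l ++ [p]).length : ℝ) = (l.length : ℝ) + 1 := by simp
      rw [hlen]
      constructor
      · have : lgrad s p m * (s.A m (key m p.1) - coef h m (key m p.1)) ≤ 2 * rad2 m := by
          refine (le_abs_self _).trans ?_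
          rw [abs_mul]
          have := hdiff (key m p.1)
          nlinarith [abs_nonneg (s.A m (key m p.1) - coef h m (key m p.1)),
            abs_nonneg (lgrad s p m)]
        show Rg m + _ ≤ _
        linarith
      · rw [astate_append]
        have hb := clipR_sq (s.A m (key m p.1) - rad2 m * sqD d m / √((s.t : ℝ) + 1) * lgrad s p m)
          (coef h m (key m p.1)) (hc _)
        rw [hst] at hb
        refine ogd_step (Rg m) (rad2 m) (sqD d m) (s.A m (key m p.1)) _ _ _ _
          (∑ k ∈ cells d m, (s.A m k - coef h m k) ^ 2) _ l.length ((cells d m).card : ℝ)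
          hR (sqD_pos d m) (sqD_sq d m).symm (Nat.cast_nonneg _) hg hb rfl ?_ ?_ i2
        · have hk := key_mem m p.1
          rw [← Finset.add_sum_erase _ _ hk, ← Finset.add_sum_erase _ _ hk]
          simp only [astep, Function.update_self]
          have : ∑ k ∈ (cells d m).erase (key m p.1), (Function.update (s.A m) (key m p.1)
              (clipR (rad2 m) (s.A m (key m p.1) - rad2 m * sqD d m / √((s.t : ℝ) + 1) *
                lgrad s p m)) k - coef h m k) ^ 2
              = ∑ k ∈ (cells d m).erase (key m p.1), (s.A m k - coef h m k) ^ 2 := by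
            apply Finset.sum_congr rfl
            intro k hk
            rw [Function.update_of_ne (Finset.ne_of_mem_erase hk)]
          rw [this, hst]
          ring
        · rw [← nsmul_eq_mul]
          apply Finset.sum_le_card_nsmul
          intro k _
          have := hdiff k
          rw [← sq_abs]
          nlinarith [abs_nonneg (s.A m k - coef h m k)]

/-- the deterministic regret bound -/
def Bnd (d T : ℕ) : ℝ :=
  ∑ m ∈ Finset.range T, min (3 * rad2 m * sqD d m * √(T : ℝ)) (2 * rad2 m * T) + 2

lemma sum_half (n : ℕ) : ∑ t ∈ Finset.range n, (1 / 2 : ℝ) ^ t ≤ 2 :=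
  (summable_geometric_two.sum_le_tsum _ (fun _ _ => by positivity)).trans tsum_geometric_two.le

lemma regret_det {d : ℕ} (T : ℕ) (h : Cube d → ℝ) (hh : h ∈ lipClass d)
    (hist : List (Cube d × ℝ)) (hy : ∀ p ∈ hist, p.2 ∈ Icc (0:ℝ) 1) (hT : hist.length = T) :
    (astate hist).L - histLoss (fun a b => |a - b|) h hist ≤ Bnd d T := by
  subst hT
  obtain ⟨Rg, h1, h2⟩ := regret_inv hist.length h hh hist hy le_rfl
  refine h1.trans (add_le_add (Finset.sum_le_sum fun m _ => ?_) (sum_half _))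
  refine le_min ?_ (h2 m).1
  refine le_trans ?_ (h2 m).2
  have : 0 ≤ √(hist.length : ℝ) / (2 * rad2 m * sqD d m) *
      ∑ k ∈ cells d m, ((astate hist).A m k - coef h m k) ^ 2 := by
    have := rad2_pos m
    have := sqD_pos d m
    have : 0 ≤ ∑ k ∈ cells d m, ((astate hist).A m k - coef h m k) ^ 2 :=
      Finset.sum_nonneg fun _ _ => sq_nonneg _
    positivity
  linarith

/-! ### The game -/

/-- similarity of observations -/
def Sim {d : ℕ} (T : ℕ) (ε : ℝ) (p q : Cube d × ℝ) : Prop :=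
  (∀ m ≤ T, key m p.1 = key m q.1) ∧ p.2 = q.2 ∧
    ‖(p.1 : Fin d → ℝ) - (q.1 : Fin d → ℝ)‖ ≤ ε

lemma Sim.refl {d : ℕ} (T : ℕ) {ε : ℝ} (hε : 0 ≤ ε) (p : Cube d × ℝ) : Sim T ε p p :=
  ⟨fun _ _ => rfl, rfl, by simpa using hε⟩

/-- agreement of states up to level `T` -/
def SAgree {d : ℕ} (T : ℕ) (s s' : AState d) : Prop :=
  s.t = s'.t ∧ ∀ m ≤ T, s.A m = s'.A m

lemma zpred_congr {d : ℕ} {T : ℕ} {s s' : AState d} (hs : SAgree T s s') (ht : s.t < T)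
    (x x' : Cube d) (hx : ∀ m ≤ T, key m x = key m x') : zpred s x = zpred s' x' := by
  unfold zpred
  rw [← hs.1]
  apply Finset.sum_congr rfl
  intro m hm
  have : m ≤ T := by have := Finset.mem_range.mp hm; omega
  rw [hs.2 m this, hx m this]

lemma foldl_congr {d : ℕ} {T : ℕ} {ε : ℝ} {l l' : List (Cube d × ℝ)}
    (hl : List.Forall₂ (Sim T ε) l l') :
    ∀ s s' : AState d, SAgree T s s' → s.t + l.length ≤ T →
      SAgree T (l.foldl astep s) (l'.foldl astep s') := by
  induction hl with
  | nil => intro s s' h _; exact h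
  | @cons p q l l' hpq _ ih =>
    intro s s' hs ht
    simp only [List.length_cons] at ht
    simp only [List.foldl_cons]
    apply ih
    · refine ⟨by simp [astep, hs.1], fun m hm => ?_⟩
      have hz := zpred_congr hs (by omega) p.1 q.1 hpq.1
      have hg : lgrad s p m = lgrad s' q m := by
        unfold lgrad
        rw [hz, hpq.2.1, hs.1]
      simp only [astep]
      rw [hg, hs.2 m hm, hpq.1 m hm, hs.1]
    · simp only [astep]; omega

lemma zpred_astate_congr {d : ℕ} {T : ℕ} {ε : ℝ} {l l' : List (Cube d × ℝ)}
    (hl : List.Forall₂ (Sim T ε) l l') (hlen : l.length < T)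
    (x x' : Cube d) (hx : ∀ m ≤ T, key m x = key m x') :
    zpred (astate l) x = zpred (astate l') x' := by
  apply zpred_congr _ _ x x' hx (T := T)
  · exact foldl_congr hl _ _ ⟨rfl, fun _ _ => rfl⟩ (by simpa using hlen.le)
  · rw [astate_t]; exact hlen

/-- The prediction rule. -/
def ruleΦ (d : ℕ) : PredRule (Cube d) := fun hist x =>
  ⟨Measure.dirac (⟨clipU (zpred (astate hist) x), clipU_mem _⟩ : UI), inferInstance⟩

lemma ruleΦ_int {d : ℕ} (hist : List (Cube d × ℝ)) (x : Cube d) (y : ℝ) :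
    ∫ yh, (fun a b : ℝ => |a - b|) (yh : ℝ) y ∂((ruleΦ d hist x).toMeasure)
      = |clipU (zpred (astate hist) x) - y| := by
  show ∫ yh, |(yh : ℝ) - y| ∂(Measure.dirac (⟨clipU (zpred (astate hist) x), clipU_mem _⟩ : UI))
    = _
  rw [integral_dirac]

/-- labels are in `[0,1]` -/
def Good {d : ℕ} (l : List (Cube d × ℝ)) : Prop := ∀ p ∈ l, p.2 ∈ Icc (0:ℝ) 1

lemma Good.append {d : ℕ} {l : List (Cube d × ℝ)} (hl : Good l) (x : Cube d) (y : UI) :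
    Good (l ++ [(x, (y:ℝ))]) := by
  intro p hp
  rw [List.mem_append, List.mem_singleton] at hp
  rcases hp with hp | rfl
  · exact hl p hp
  · exact y.2

abbrev absLoss : ℝ → ℝ → ℝ := fun a b => |a - b|

instance lipClass_nonempty (d : ℕ) : Nonempty (lipClass d) :=
  ⟨⟨fun _ => 0, fun _ => ⟨le_rfl, zero_le_one⟩, fun u v => by simp⟩⟩

lemma abs_le_one_of_mem {a b : ℝ} (ha : a ∈ Icc (0:ℝ) 1) (hb : b ∈ Icc (0:ℝ) 1) :
    |a - b| ≤ 1 := by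
  rw [abs_le]; constructor <;> linarith [ha.1, ha.2, hb.1, hb.2]

lemma histLoss_nonneg {d : ℕ} (h : Cube d → ℝ) (l : List (Cube d × ℝ)) :
    0 ≤ histLoss absLoss h l := by
  apply List.sum_nonneg
  intro a ha
  obtain ⟨p, _, rfl⟩ := List.mem_map.mp ha
  exact abs_nonneg _

lemma histLoss_le {d : ℕ} (h : Cube d → ℝ) (hh : h ∈ lipClass d) (l : List (Cube d × ℝ))
    (hl : Good l) : histLoss absLoss h l ≤ l.length := by
  induction l with
  | nil => simp [histLoss]
  | cons p l ih =>
    have h1 := ih (fun q hq => hl q (by simp [hq]))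
    have h2 := abs_le_one_of_mem (hh.1 p.1) (hl p (by simp))
    simp only [histLoss, List.map_cons, List.sum_cons, List.length_cons] at h1 ⊢
    push_cast
    linarith

lemma histLoss_sim {d : ℕ} {T : ℕ} {ε : ℝ} (h : Cube d → ℝ) (hh : h ∈ lipClass d)
    {l l' : List (Cube d × ℝ)} (hl : List.Forall₂ (Sim T ε) l l') :
    |histLoss absLoss h l - histLoss absLoss h l'| ≤ l.length * ε := by
  induction hl with
  | nil => simp [histLoss]
  | @cons p q l l' hpq _ ih =>
    simp only [histLoss, List.map_cons, List.sum_cons, List.length_cons] at ih ⊢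
    have h1 : |(|h p.1 - p.2| - |h q.1 - q.2|)| ≤ ε := by
      refine (abs_abs_sub_abs_le_abs_sub _ _).trans ?_
      rw [hpq.2.1]
      refine le_trans (le_of_eq ?_) ((hh.2 p.1 q.1).trans hpq.2.2)
      congr 1; ring
    rw [abs_le] at h1 ih ⊢
    push_cast
    constructor <;> linarith [h1.1, h1.2, ih.1, ih.2]

lemma abs_iInf_sub_le {ι : Type*} [Nonempty ι] (f g : ι → ℝ) (c : ℝ)
    (hf : BddBelow (range f)) (hg : BddBelow (range g)) (h : ∀ i, |f i - g i| ≤ c) :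
    |(⨅ i, f i) - ⨅ i, g i| ≤ c := by
  rw [abs_le]
  constructor
  · have : (⨅ i, g i) - c ≤ ⨅ i, f i := le_ciInf fun i => by
      have := ciInf_le hg i
      have := abs_le.mp (h i)
      linarith
    linarith
  · have : (⨅ i, f i) - c ≤ ⨅ i, g i := le_ciInf fun i => by
      have := ciInf_le hf i
      have := abs_le.mp (h i)
      linarith
    linarith

lemma abs_iSup_sub_le {ι : Type*} [Nonempty ι] (f g : ι → ℝ) (c : ℝ)
    (hf : BddAbove (range f)) (hg : BddAbove (range g)) (h : ∀ i, |f i - g i| ≤ c) :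
    |(⨆ i, f i) - ⨆ i, g i| ≤ c := by
  rw [abs_le]
  constructor
  · have : (⨆ i, g i) ≤ (⨆ i, f i) + c := ciSup_le fun i => by
      have := le_ciSup hf i
      have := abs_le.mp (h i)
      linarith
    linarith
  · have : (⨆ i, f i) ≤ (⨆ i, g i) + c := ciSup_le fun i => by
      have := le_ciSup hg i
      have := abs_le.mp (h i)
      linarith
    linarith

lemma abs_iSup_le {ι : Type*} [Nonempty ι] (f : ι → ℝ) (c : ℝ)
    (h : ∀ i, |f i| ≤ c) : |⨆ i, f i| ≤ c := by
  have hb : BddAbove (range f) := ⟨c, by rintro _ ⟨i, rfl⟩; exact (le_abs_self _).trans (h i)⟩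
  obtain ⟨i⟩ := ‹Nonempty ι›
  rw [abs_le]
  constructor
  · exact (abs_le.mp (h i)).1.trans (le_ciSup hb i)
  · haveI : Nonempty ι := ⟨i⟩
    exact ciSup_le fun i => (abs_le.mp (h i)).2

/-- functions Lipschitz on the cells are measurable -/
lemma measurable_of_cells {d : ℕ} (T : ℕ) (f : Cube d → ℝ) (K : ℝ)
    (hf : ∀ x x' : Cube d, (∀ m ≤ T, key m x = key m x') →
      |f x - f x'| ≤ K * ‖(x : Fin d → ℝ) - (x' : Fin d → ℝ)‖) : Measurable f := by
  let c : Cube d → (Fin (T + 1) → Fin d → ℕ) := fun x m => key m x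
  have hc : Measurable c := by
    refine measurable_pi_lambda _ fun m => measurable_pi_lambda _ fun i => ?_
    refine Nat.measurable_floor.comp ?_
    exact ((measurable_pi_apply i).comp measurable_subtype_coe).const_mul _
  apply measurable_of_isOpen
  intro U hU
  have hset : f ⁻¹' U = ⋃ i, (f ⁻¹' U ∩ c ⁻¹' {i}) := by
    ext x; simp
  rw [hset]
  refine MeasurableSet.iUnion fun i => ?_
  have hcont : ContinuousOn f (c ⁻¹' {i}) := by
    have : LipschitzOnWith K.toNNReal f (c ⁻¹' {i}) := by
      apply LipschitzOnWith.of_dist_le_mul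
      intro x hx x' hx'
      have hxx : c x = c x' := by
        rw [mem_preimage, mem_singleton_iff] at hx hx'
        rw [hx, hx']
      have := hf x x' (fun m hm => congrFun hxx ⟨m, by omega⟩)
      rw [Real.dist_eq, Subtype.dist_eq, dist_eq_norm]
      refine this.trans ?_
      exact mul_le_mul_of_nonneg_right (Real.le_coe_toNNReal K) (norm_nonneg _)
    exact this.continuousOn
  obtain ⟨V, hV, hVe⟩ := (continuousOn_iff'.mp hcont) U hU
  rw [hVe]
  exact hV.measurableSet.inter (hc (measurableSet_singleton i))

/-- the main induction -/
lemma game_main {d : ℕ} (T : ℕ) (μ : Measure (Cube d)) [IsProbabilityMeasure μ] (r : ℕ) :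
    ∀ l : List (Cube d × ℝ), Good l → l.length + r = T →
      |gameVal (lipClass d) absLoss μ (ruleΦ d) r l| ≤ l.length + 2 * r ∧
      (∀ ε : ℝ, 0 ≤ ε → ∀ l', Good l' → List.Forall₂ (Sim T ε) l l' →
        |gameVal (lipClass d) absLoss μ (ruleΦ d) r l -
          gameVal (lipClass d) absLoss μ (ruleΦ d) r l'| ≤ T * ε) ∧
      gameVal (lipClass d) absLoss μ (ruleΦ d) r l ≤ Bnd d T - (astate l).L := by
  induction r with
  | zero =>
    intro l hl hlen
    have hbd : ∀ l : List (Cube d × ℝ),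
        BddBelow (range fun h : lipClass d => histLoss absLoss (h : Cube d → ℝ) l) := fun l =>
      ⟨0, by rintro _ ⟨h, rfl⟩; exact histLoss_nonneg _ _⟩
    simp only [gameVal]
    refine ⟨?_, ?_, ?_⟩
    · rw [abs_neg, abs_le]
      have h0 : 0 ≤ ⨅ h : lipClass d, histLoss absLoss (h : Cube d → ℝ) l :=
        le_ciInf fun h => histLoss_nonneg _ _
      obtain ⟨h⟩ := lipClass_nonempty d
      have h1 := (ciInf_le (hbd l) h).trans (histLoss_le _ h.2 l hl)
      have : (0:ℝ) ≤ l.length := Nat.cast_nonneg _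
      push_cast
      constructor <;> linarith
    · intro ε hε l' _ hsim
      have := abs_iInf_sub_le _ _ (T * ε) (hbd l) (hbd l') (fun h => by
        have := histLoss_sim (h : Cube d → ℝ) h.2 hsim
        have e : (l.length : ℝ) = T := by exact_mod_cast hlen
        rwa [e] at this)
      rw [abs_sub_comm] at this
      convert this using 2
      ring
    · have : (astate l).L - Bnd d T ≤ ⨅ h : lipClass d, histLoss absLoss (h : Cube d → ℝ) l :=
        le_ciInf fun h => by
          have := regret_det T (h : Cube d → ℝ) h.2 l hl hlen
          linarith
      linarith
  | succ r ih =>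
    -- value of a round
    set V : List (Cube d × ℝ) → Cube d → UI → ℝ := fun l x y =>
      |clipU (zpred (astate l) x) - (y : ℝ)| +
        gameVal (lipClass d) absLoss μ (ruleΦ d) r (l ++ [(x, (y : ℝ))]) with hV
    have hgv : ∀ l, gameVal (lipClass d) absLoss μ (ruleΦ d) (r + 1) l
        = ∫ x, (⨆ y : UI, V l x y) ∂μ := by
      intro l
      simp only [gameVal, hV]
      congr 1
      ext x
      congr 1
      ext y
      congr 1
      exact ruleΦ_int l x y
    have hlen' : ∀ (l : List (Cube d × ℝ)) x (y : UI), l.length + (r + 1) = T →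
        (l ++ [(x, (y : ℝ))]).length + r = T := by
      intro l x y h; simp; omega
    have hVabs : ∀ l, Good l → l.length + (r + 1) = T → ∀ x y,
        |V l x y| ≤ l.length + 2 * ((r + 1 : ℕ) : ℝ) := by
      intro l hl hlen x y
      have h1 := (ih _ (hl.append x y) (hlen' l x y hlen)).1
      have h2 := abs_le_one_of_mem (clipU_mem (zpred (astate l) x)) y.2
      refine (abs_add_le _ _).trans ?_
      rw [abs_abs]
      simp only [List.length_append, List.length_singleton] at h1
      push_cast at h1 ⊢
      linarith
    have hVbdd : ∀ l, Good l → l.length + (r + 1) = T → ∀ x, BddAbove (range (V l x)) := by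
      intro l hl hlen x
      exact ⟨l.length + 2 * ((r + 1 : ℕ) : ℝ), by
        rintro _ ⟨y, rfl⟩; exact (le_abs_self _).trans (hVabs l hl hlen x y)⟩
    have hVsim : ∀ ε : ℝ, 0 ≤ ε → ∀ l l', Good l → Good l' → l.length + (r + 1) = T →
        List.Forall₂ (Sim T ε) l l' → ∀ x x' : Cube d, (∀ m ≤ T, key m x = key m x') →
        ‖(x : Fin d → ℝ) - (x' : Fin d → ℝ)‖ ≤ ε → ∀ y, |V l x y - V l' x' y| ≤ T * ε := by
      intro ε hε l l' hl hl' hlen hsim x x' hxx hd y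
      have h1 := (ih _ (hl.append x y) (hlen' l x y hlen)).2.1 ε hε (l' ++ [(x', (y:ℝ))])
        (hl'.append x' y) (List.rel_append hsim (List.Forall₂.cons ⟨hxx, rfl, hd⟩ .nil))
      have h2 := zpred_astate_congr hsim (by omega) x x' hxx
      simp only [hV, h2]
      rwa [add_sub_add_left_eq_sub]
    have hmeas : ∀ l, Good l → l.length + (r + 1) = T → Measurable fun x => ⨆ y : UI, V l x y := by
      intro l hl hlen
      apply measurable_of_cells T _ T
      intro x x' hxx
      apply abs_iSup_sub_le _ _ _ (hVbdd l hl hlen x) (hVbdd l hl hlen x')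
      exact hVsim _ (norm_nonneg _) l l hl hl hlen
        (List.forall₂_same.mpr fun p _ => Sim.refl T (norm_nonneg _) p) x x' hxx le_rfl
    have hSabs : ∀ l, Good l → l.length + (r + 1) = T → ∀ x,
        ‖⨆ y : UI, V l x y‖ ≤ l.length + 2 * ((r + 1 : ℕ) : ℝ) := by
      intro l hl hlen x
      exact abs_iSup_le _ _ (hVabs l hl hlen x)
    have hint : ∀ l, Good l → l.length + (r + 1) = T →
        Integrable (fun x => ⨆ y : UI, V l x y) μ := by
      intro l hl hlen
      exact Integrable.of_bound (hmeas l hl hlen).aestronglyMeasurable _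
        (Filter.Eventually.of_forall (hSabs l hl hlen))
    intro l hl hlen
    refine ⟨?_, ?_, ?_⟩
    · rw [hgv]
      have := norm_integral_le_of_norm_le_const (μ := μ)
        (Filter.Eventually.of_forall (hSabs l hl hlen))
      simpa using this
    · intro ε hε l' hl' hsim
      have hlen2 : l'.length + (r + 1) = T := by rw [← hsim.length_eq]; exact hlen
      rw [hgv, hgv, ← integral_sub (hint l hl hlen) (hint l' hl' hlen2)]
      have := norm_integral_le_of_norm_le_const (μ := μ)
        (f := fun x => (⨆ y : UI, V l x y) - ⨆ y : UI, V l' x y) (C := T * ε)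
        (Filter.Eventually.of_forall fun x => by
          rw [Real.norm_eq_abs]
          apply abs_iSup_sub_le _ _ _ (hVbdd l hl hlen x) (hVbdd l' hl' hlen2 x)
          exact hVsim ε hε l l' hl hl' hlen hsim x x (fun _ _ => rfl) (by simpa using hε))
      simpa using this
    · rw [hgv]
      have : ∫ x, (⨆ y : UI, V l x y) ∂μ ≤ ∫ _x, (Bnd d T - (astate l).L) ∂μ := by
        apply integral_mono (hint l hl hlen) (integrable_const _)
        intro x
        apply ciSup_le
        intro y
        have h1 := (ih _ (hl.append x y) (hlen' l x y hlen)).2.2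
        rw [astate_append] at h1
        simp only [astep] at h1
        simp only [hV]
        linarith
      simpa using this

/-! ### Numerical bounds -/

/-- per-level numerical bound -/
lemma level_num (d : ℕ) (hd : 1 ≤ d) (x T : ℝ) (hx : 1 ≤ x) (hT : 1 ≤ T) :
    min (x⁻¹ * √(x ^ d) * √T) (x⁻¹ * T) ≤ T ^ (max ((1:ℝ)/2) (((d : ℝ) - 1) / (d : ℝ))) := by
  have hx0 : 0 < x := by linarith
  have hT0 : 0 < T := by linarith
  have hd0 : (0:ℝ) < d := by exact_mod_cast hd
  rcases le_or_gt (x ^ d) T with hc | hc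
  · refine (min_le_left _ _).trans ?_
    rcases eq_or_lt_of_le hd with h1 | h2
    · subst h1
      have e : x⁻¹ * √(x ^ 1) ≤ 1 := by
        rw [pow_one, inv_mul_le_iff₀ hx0, mul_one, Real.sqrt_le_left (by linarith)]
        nlinarith
      calc x⁻¹ * √(x ^ 1) * √T ≤ 1 * √T := by gcongr
        _ = T ^ ((1:ℝ)/2) := by rw [one_mul, Real.sqrt_eq_rpow]
        _ ≤ _ := Real.rpow_le_rpow_of_exponent_le hT (le_max_left _ _)
    · have h2' : (2:ℝ) ≤ d := by exact_mod_cast h2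
      have hexp : (0:ℝ) ≤ 1/2 - 1/d := by
        have : (1:ℝ)/d ≤ 1/2 := one_div_le_one_div_of_le (by norm_num) h2'
        linarith
      have e1 : x⁻¹ * √(x ^ d) = (x ^ d) ^ ((1:ℝ)/2 - 1/d) := by
        rw [Real.rpow_sub (by positivity), ← Real.sqrt_eq_rpow, one_div (d:ℝ),
          Real.pow_rpow_inv_natCast hx0.le (by omega)]
        field_simp
      calc x⁻¹ * √(x ^ d) * √T ≤ T ^ ((1:ℝ)/2 - 1/d) * T ^ ((1:ℝ)/2) := by
            rw [e1, Real.sqrt_eq_rpow]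
            gcongr
        _ = T ^ (((d : ℝ) - 1) / (d : ℝ)) := by
            rw [← Real.rpow_add hT0]
            congr 1
            field_simp
            ring
        _ ≤ _ := Real.rpow_le_rpow_of_exponent_le hT (le_max_right _ _)
  · refine (min_le_right _ _).trans ?_
    have e1 : T ^ ((1:ℝ)/d) ≤ x := by
      have := Real.rpow_le_rpow hT0.le hc.le (show (0:ℝ) ≤ (d:ℝ)⁻¹ by positivity)
      rwa [Real.pow_rpow_inv_natCast hx0.le (by omega), ← one_div] at this
    calc x⁻¹ * T ≤ (T ^ ((1:ℝ)/d))⁻¹ * T := by gcongr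
      _ = T ^ (((d : ℝ) - 1) / (d : ℝ)) := by
        rw [sub_div, div_self hd0.ne', Real.rpow_sub hT0, Real.rpow_one]
        field_simp
      _ ≤ _ := Real.rpow_le_rpow_of_exponent_le hT (le_max_right _ _)

lemma level_bound (d : ℕ) (hd : 1 ≤ d) (m : ℕ) (T : ℝ) (hT : 1 ≤ T) :
    min (3 * rad2 m * sqD d m * √T) (2 * rad2 m * T) ≤
      3 * 2 ^ d * T ^ (max ((1:ℝ)/2) (((d : ℝ) - 1) / (d : ℝ))) := by
  have hx : (1:ℝ) ≤ 2 ^ m := one_le_pow₀ (by norm_num)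
  have h := level_num d hd (2 ^ m) T hx hT
  have hr : rad2 m = ((2:ℝ) ^ m)⁻¹ := by simp [rad2]
  have h2d : (1:ℝ) ≤ 2 ^ d := one_le_pow₀ (by norm_num)
  have hq : sqD d m ≤ 2 ^ d * √(((2:ℝ) ^ m) ^ d) := by
    unfold sqD
    rw [Real.sqrt_le_left (by positivity), mul_pow, Real.sq_sqrt (by positivity)]
    calc ((2:ℝ) ^ m + 1) ^ d ≤ (2 * 2 ^ m) ^ d := by gcongr; linarith
      _ = 2 ^ d * ((2:ℝ) ^ m) ^ d := mul_pow _ _ _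
      _ ≤ (2 ^ d) ^ 2 * ((2:ℝ) ^ m) ^ d := by
        gcongr
        nlinarith
  have hc : (0:ℝ) ≤ 3 * 2 ^ d := by positivity
  refine le_trans ?_ (mul_le_mul_of_nonneg_left h hc)
  rw [mul_min_of_nonneg _ _ hc, hr]
  apply min_le_min
  · calc 3 * ((2:ℝ) ^ m)⁻¹ * sqD d m * √T
        ≤ 3 * ((2:ℝ) ^ m)⁻¹ * (2 ^ d * √(((2:ℝ) ^ m) ^ d)) * √T := by gcongr
      _ = _ := by ring
  · have : 0 ≤ ((2:ℝ) ^ m)⁻¹ * T := by positivity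
    nlinarith

lemma Bnd_le (d : ℕ) (hd : 1 ≤ d) (T : ℕ) (hT : 2 ≤ T) :
    Bnd d T ≤ (6 * 2 ^ d + 6) / Real.log 2 * (Real.log T) ^ (1:ℝ) *
      (T : ℝ) ^ (max ((1:ℝ)/2) (((d : ℝ) - 1) / (d : ℝ))) := by
  set α := max ((1:ℝ)/2) (((d : ℝ) - 1) / (d : ℝ)) with hα
  have hT1 : (1:ℝ) ≤ T := by exact_mod_cast (by omega : 1 ≤ T)
  set P := (T:ℝ) ^ α with hP
  have hP1 : 1 ≤ P := Real.one_le_rpow hT1 (le_trans (by norm_num) (le_max_left _ _))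
  set M := Nat.log 2 T + 1 with hM
  set b : ℕ → ℝ := fun m => min (3 * rad2 m * sqD d m * √(T : ℝ)) (2 * rad2 m * T) with hb
  have hb0 : ∀ m, 0 ≤ b m := fun m => by
    have := rad2_pos m
    have := sqD_pos d m
    apply le_min <;> positivity
  have h1 : ∑ m ∈ Finset.range T, b m ≤ ∑ m ∈ Finset.range (M + T), b m :=
    Finset.sum_le_sum_of_subset_of_nonneg (Finset.range_subset_range.mpr (by omega))
      (fun m _ _ => hb0 m)
  have h2 : ∑ m ∈ Finset.range M, b m ≤ M * (3 * 2 ^ d * P) := by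
    have := Finset.sum_le_card_nsmul (Finset.range M) b (3 * 2 ^ d * P)
      (fun m _ => level_bound d hd m T hT1)
    simpa using this
  have hTM : (T:ℝ) ≤ 2 ^ M := by
    exact_mod_cast (Nat.lt_pow_succ_log_self (by norm_num : 1 < 2) T).le
  have h3 : ∑ j ∈ Finset.range T, b (M + j) ≤ 4 := by
    have : ∑ j ∈ Finset.range T, b (M + j) ≤ ∑ j ∈ Finset.range T, 2 * (1 / 2 : ℝ) ^ j := by
      refine Finset.sum_le_sum fun j _ => (min_le_right _ _).trans ?_
      have e : rad2 (M + j) * 2 ^ M = (1 / 2) ^ j := by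
        unfold rad2
        rw [pow_add, mul_right_comm, ← mul_pow]
        norm_num
      have := mul_le_mul_of_nonneg_left hTM (rad2_pos (M + j)).le
      rw [e] at this
      linarith
    rw [← Finset.mul_sum] at this
    linarith [sum_half T]
  rw [Finset.sum_range_add] at h1
  have hl2 : 0 < Real.log 2 := Real.log_pos (by norm_num)
  have hlT : Real.log 2 ≤ Real.log T :=
    Real.log_le_log (by norm_num) (by exact_mod_cast hT)
  set Λ := Real.log T / Real.log 2 with hΛ
  have hΛ1 : 1 ≤ Λ := by rw [hΛ, le_div_iff₀ hl2]; linarith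
  have hMΛ : (M:ℝ) ≤ 2 * Λ := by
    have : (Nat.log 2 T : ℝ) ≤ Λ := by
      rw [hΛ, le_div_iff₀ hl2, ← Real.log_pow]
      apply Real.log_le_log (by positivity)
      exact_mod_cast Nat.pow_log_le_self 2 (by omega)
    rw [hM]; push_cast; linarith
  have h4 : (M:ℝ) * (3 * 2 ^ d * P) ≤ 2 * Λ * (3 * 2 ^ d * P) := by gcongr
  have h5 : 1 ≤ Λ * P := one_le_mul_of_one_le_of_one_le hΛ1 hP1
  have h6 : (6 * 2 ^ d + 6) / Real.log 2 * (Real.log T) ^ (1:ℝ) * P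
      = 2 * Λ * (3 * 2 ^ d * P) + 6 * (Λ * P) := by
    rw [Real.rpow_one, hΛ]; field_simp; ring
  rw [h6]
  show ∑ m ∈ Finset.range T, b m + 2 ≤ _
  linarith

/-- **Theorem 14.** For the class `H` of all `1`-Lipschitz functions
`([0,1]^d, ‖·‖_∞) → [0,1]` with the absolute loss, there exist constants `C, c > 0`
(depending only on `d`) and a prediction rule `Φ` such that
`r̃_T(H,Φ) ≤ C·(log T)^c·T^{max{1/2,(d−1)/d}}` for all `T ≥ 2`. -/
theorem hybrid_regret_lipschitz (d : ℕ) (hd : 1 ≤ d) :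
    ∃ C c : ℝ, 0 < C ∧ 0 < c ∧
      ∃ Φ : PredRule (Cube d), ∀ T : ℕ, 2 ≤ T →
        hybridRegret (lipClass d) (fun a b => |a - b|) Φ T ≤
          C * (Real.log T) ^ c *
            (T : ℝ) ^ (max ((1:ℝ)/2) (((d : ℝ) - 1) / (d : ℝ))) := by
  have hl2 : 0 < Real.log 2 := Real.log_pos (by norm_num)
  refine ⟨(6 * 2 ^ d + 6) / Real.log 2, 1, by positivity, one_pos, ruleΦ d, fun T hT => ?_⟩
  refine le_trans ?_ (Bnd_le d hd T hT)
  haveI : Nonempty (ProbabilityMeasure (Cube d)) :=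
    ⟨⟨Measure.dirac ⟨0, le_rfl, zero_le_one⟩, inferInstance⟩⟩
  refine ciSup_le fun μ => ?_
  have h := (game_main T (μ : Measure (Cube d)) T [] (fun p hp => by simp at hp) (by simp)).2.2
  simpa [astate] using h

end
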